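/- For all real a > 0 and p > 0: ∫₀^{a} max(√x, √p)/√(x·(a − x)) dx = 2·(√(a − p) + √p · arcsin √(p/a)) if p < a, and = π·√p if p ≥ a. -/

import Mathlib

open MeasureTheory Real

lemma aux_ftc (F f : ℝ → ℝ) (u v : ℝ) (huv : u ≤ v) (hc : Continuous F)
    (hd : ∀ x ∈ Set.Ioo u v, HasDerivAt F (f x) x) (hf : ∀ x, 0 ≤ f x) :
    IntervalIntegrable f volume u v ∧ ∫ x in u..v, f x = F v - F u := by
  have hi : IntervalIntegrable f volume u v := by
    apply intervalIntegral.intervalIntegrable_deriv_of_nonneg hc.continuousOn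
    · rw [min_eq_left huv, max_eq_right huv]; exact hd
    · intro x _; exact hf x
  exact ⟨hi, intervalIntegral.integral_eq_sub_of_hasDerivAt_of_le huv hc.continuousOn hd hi⟩

lemma aux_left (a p u : ℝ) (ha : 0 < a) (hu : 0 ≤ u) (hua : u ≤ a) (hup : u ≤ p) :
    IntervalIntegrable (fun x => max (Real.sqrt x) (Real.sqrt p) / Real.sqrt (x*(a - x))) volume 0 u ∧
    ∫ x in (0:ℝ)..u, max (Real.sqrt x) (Real.sqrt p) / Real.sqrt (x*(a - x)) =
      2 * Real.sqrt p * Real.arcsin (Real.sqrt (u/a)) := by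
  have h := aux_ftc (fun x => 2 * Real.sqrt p * Real.arcsin (Real.sqrt (x/a)))
    (fun x => max (Real.sqrt x) (Real.sqrt p) / Real.sqrt (x*(a - x))) 0 u hu
    (by fun_prop) ?_ (fun x => by positivity)
  · simpa using h
  · rintro x ⟨hx0, hxu⟩
    have hxa : x < a := by linarith
    have hq : 0 < x / a := by positivity
    have hq1 : x / a < 1 := (div_lt_one ha).2 hxa
    have hs1 : √(x/a) < 1 := by rw [Real.sqrt_lt' one_pos]; simpa using hq1
    have hs0 : 0 < √(x/a) := Real.sqrt_pos.2 hq
    have h1 : HasDerivAt (fun x : ℝ => √(x/a)) _ x :=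
      ((hasDerivAt_id x).div_const a).sqrt hq.ne'
    have h2 := ((Real.hasDerivAt_arcsin (x := √(x/a)) (by linarith) hs1.ne).comp x h1).const_mul
      (2 * √p)
    refine h2.congr_deriv ?_
    rw [max_eq_right (Real.sqrt_le_sqrt (by linarith)), Real.sq_sqrt hq.le]
    have e : √(x * (a - x)) = a * (√(1 - x/a) * √(x/a)) := by
      rw [← Real.sqrt_mul (by linarith), show x * (a-x) = a^2 * ((1 - x/a) * (x/a)) by field_simp,
        Real.sqrt_mul (by positivity), Real.sqrt_sq ha.le]
    have : 0 < √(1 - x/a) := Real.sqrt_pos.2 (by linarith)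
    simp only [id]
    rw [e]
    generalize √(1 - x/a) = s at *
    generalize √(x/a) = t at *
    field_simp

lemma aux_right (a p : ℝ) (hp : 0 < p) (hpa : p ≤ a) :
    IntervalIntegrable (fun x => max (Real.sqrt x) (Real.sqrt p) / Real.sqrt (x*(a - x))) volume p a ∧
    ∫ x in p..a, max (Real.sqrt x) (Real.sqrt p) / Real.sqrt (x*(a - x)) =
      2 * Real.sqrt (a - p) := by
  have h := aux_ftc (fun x => - (2 * Real.sqrt (a - x)))
    (fun x => max (Real.sqrt x) (Real.sqrt p) / Real.sqrt (x*(a - x))) p a hpa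
    (by fun_prop) ?_ (fun x => by positivity)
  · simpa using h
  · rintro x ⟨hx0, hxu⟩
    have hq : 0 < a - x := by linarith
    have h1 : HasDerivAt (fun x : ℝ => √(a - x)) _ x :=
      ((hasDerivAt_id x).const_sub a).sqrt hq.ne'
    refine (h1.const_mul 2).neg.congr_deriv ?_
    rw [max_eq_left (Real.sqrt_le_sqrt hx0.le), Real.sqrt_mul (by linarith)]
    have : 0 < √(a - x) := Real.sqrt_pos.2 hq
    have : 0 < √x := Real.sqrt_pos.2 (by linarith)
    simp only [id]
    field_simp

/-- The zeroth moment of the energy transfer rate of the Markov jump process of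
energy exchanges (`a` is the ball energy, `p` the piston energy). -/
theorem stmt_12 (a p : ℝ) (ha : 0 < a) (hp : 0 < p) :
    (p < a →
      ∫ x in (0:ℝ)..a, max (Real.sqrt x) (Real.sqrt p) / Real.sqrt (x*(a - x)) =
        2 * (Real.sqrt (a - p) + Real.sqrt p * Real.arcsin (Real.sqrt (p/a)))) ∧
    (a ≤ p →
      ∫ x in (0:ℝ)..a, max (Real.sqrt x) (Real.sqrt p) / Real.sqrt (x*(a - x)) =
        Real.pi * Real.sqrt p) := by
  constructor
  · intro h
    obtain ⟨i1, e1⟩ := aux_left a p p ha hp.le h.le le_rfl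
    obtain ⟨i2, e2⟩ := aux_right a p hp h.le
    rw [← intervalIntegral.integral_add_adjacent_intervals i1 i2, e1, e2]
    ring
  · intro h
    rw [(aux_left a p a ha ha.le le_rfl h).2, div_self ha.ne', Real.sqrt_one, Real.arcsin_one]
    ring
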